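/- Let G be a unicyclic graph whose unique cycle is the odd cycle C_{2n+1} = (x_1,…,x_{2n+1}) (n ≥ 1), let I = I(G) be its edge ideal, c = x_1⋯x_{2n+1}, and l = |E(G)| − (2n+1). For each size j let d_j be the number of subsets of E(G) of size j containing some Type-I or Type-II minimum edge cover for C_{2n+1} in G. For s ≥ 2n+2, let 𝒢_{s−(n+1)} be the set of minimal monomial generators of I^{s−(n+1)} that are not a multiple of any minimal monomial generator of the ideal I^{s−2(n+1)}·(c). Then for all s ≥ 2n+2: |𝒢_{s−(n+1)}| = ((2n+1+l) multichoose (s−(n+1))) − Σ_{j=0}^{n+l} d_{n+1+j} · ((n+1+j) multichoose (s−2(n+1)−j)), where (a multichoose b) = C(a+b−1, b) and (a multichoose b) = 0 for b < 0. -/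

import Mathlib

open MvPolynomial

noncomputable section

/-- The edge ideal of a simple graph: `I(G) = ⟨X_u · X_v : {u,v} ∈ E(G)⟩`. -/
def edgeIdeal (𝕜 : Type) [Field 𝕜] {V : Type} (G : SimpleGraph V) :
    Ideal (MvPolynomial V 𝕜) :=
  Ideal.span {p | ∃ u v : V, G.Adj u v ∧ p = X u * X v}

/-- `G` is a unicyclic graph (connected with exactly one cycle, equivalently connected with as
many edges as vertices) whose unique cycle is the odd cycle `C_{2n+1}` on the vertices `x j`. -/
structure IsUnicyclicOddCycle {V : Type} [Fintype V] (G : SimpleGraph V) (n : ℕ)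
    (x : ZMod (2 * n + 1) → V) : Prop where
  connected : G.Connected
  edge_count : G.edgeSet.ncard = Fintype.card V
  inj : Function.Injective x
  adj_iff : ∀ i j : ZMod (2 * n + 1), G.Adj (x i) (x j) ↔ (j = i + 1 ∨ i = j + 1)

/-- `f` is a minimal monomial generator of the monomial ideal `J`: it is a monic monomial
belonging to `J` such that no monic monomial of `J` properly divides it. -/
def IsMinMonomialGen {𝕜 : Type} [Field 𝕜] {V : Type} (J : Ideal (MvPolynomial V 𝕜))
    (f : MvPolynomial V 𝕜) : Prop :=
  (∃ m : V →₀ ℕ, f = monomial m 1) ∧ f ∈ J ∧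
    ∀ g : MvPolynomial V 𝕜, (∃ m : V →₀ ℕ, g = monomial m 1) → g ∈ J → g ∣ f → g = f


/-- The edge set of the cycle `C_{2n+1}` with vertices `x 0, x 1, …, x (2n)`. -/
def cycleEdges {V : Type} (n : ℕ) (x : ZMod (2 * n + 1) → V) : Set (Sym2 V) :=
  Set.range fun j => s(x j, x (j + 1))

/-- `G` contains the cycle `C_{2n+1}` on the vertices `x j` as an induced subgraph. -/
structure HasInducedOddCycle {V : Type} (G : SimpleGraph V) (n : ℕ)
    (x : ZMod (2 * n + 1) → V) : Prop where
  inj : Function.Injective x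
  adj_iff : ∀ i j : ZMod (2 * n + 1), G.Adj (x i) (x j) ↔ (j = i + 1 ∨ i = j + 1)

/-- `L` is an edge cover for the cycle `C_{2n+1}` (with vertices `x j`) in `G`:
every vertex of the cycle is incident to some edge of `L`. -/
def IsEdgeCoverFor {V : Type} (G : SimpleGraph V) (n : ℕ) (x : ZMod (2 * n + 1) → V)
    (L : Finset (Sym2 V)) : Prop :=
  (↑L : Set (Sym2 V)) ⊆ G.edgeSet ∧ ∀ j : ZMod (2 * n + 1), ∃ e ∈ L, x j ∈ e

/-- A Type-I edge cover: all its edges are edges of the cycle. -/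
def IsTypeICover {V : Type} (G : SimpleGraph V) (n : ℕ) (x : ZMod (2 * n + 1) → V)
    (L : Finset (Sym2 V)) : Prop :=
  IsEdgeCoverFor G n x L ∧ (↑L : Set (Sym2 V)) ⊆ cycleEdges n x

/-- A Type-I minimum edge cover: a Type-I edge cover of smallest possible size. -/
def IsTypeIMinCover {V : Type} (G : SimpleGraph V) (n : ℕ) (x : ZMod (2 * n + 1) → V)
    (L : Finset (Sym2 V)) : Prop :=
  IsTypeICover G n x L ∧ ∀ L' : Finset (Sym2 V), IsTypeICover G n x L' → L.card ≤ L'.card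

/-- A finite set of edges is a matching if its edges are pairwise disjoint. -/
def IsMatchingSet {V : Type} (M : Finset (Sym2 V)) : Prop :=
  ∀ e ∈ M, ∀ f ∈ M, e ≠ f → ∀ v : V, ¬(v ∈ e ∧ v ∈ f)

/-- `v` is saturated by the matching `M`. -/
def Saturates {V : Type} (M : Finset (Sym2 V)) (v : V) : Prop :=
  ∃ e ∈ M, v ∈ e

/-- A Type-II edge cover: it contains at least one edge of `E(G) ∖ E(C_{2n+1})`. -/
def IsTypeIICover {V : Type} (G : SimpleGraph V) (n : ℕ) (x : ZMod (2 * n + 1) → V)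
    (L : Finset (Sym2 V)) : Prop :=
  IsEdgeCoverFor G n x L ∧ ∃ e ∈ L, e ∉ cycleEdges n x

/-- A Type-II minimum edge cover: a Type-II edge cover of smallest possible size. -/
def IsTypeIIMinCover {V : Type} (G : SimpleGraph V) (n : ℕ) (x : ZMod (2 * n + 1) → V)
    (L : Finset (Sym2 V)) : Prop :=
  IsTypeIICover G n x L ∧ ∀ L' : Finset (Sym2 V), IsTypeIICover G n x L' → L.card ≤ L'.card


/-- `multichoose a b = C(a+b-1, b)`, the number of `b`-element multisets on `a` elements. -/
def multichoose (a b : ℕ) : ℕ := Nat.choose (a + b - 1) b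

/-! ### Counting multisets -/

open scoped Classical in
/-- multisets of size `k` with elements in `T` -/
def msets {α : Type} (T : Finset α) (k : ℕ) : Finset (Multiset α) :=
  Finset.univ.image (fun s : Sym T k => (s : Multiset T).map Subtype.val)

lemma mem_msets {α : Type} (T : Finset α) (k : ℕ) (b : Multiset α) :
    b ∈ msets T k ↔ (∀ e ∈ b, e ∈ T) ∧ b.card = k := by
  classical
  unfold msets
  simp only [Finset.mem_image, Finset.mem_univ, true_and]
  constructor
  · rintro ⟨s, rfl⟩
    refine ⟨?_, ?_⟩
    · intro e he
      rw [Multiset.mem_map] at he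
      obtain ⟨a, _, rfl⟩ := he
      exact a.2
    · rw [Multiset.card_map]; exact s.2
  · rintro ⟨h1, h2⟩
    refine ⟨⟨b.attach.map (fun e => ⟨e.1, h1 e.1 e.2⟩), by simpa using h2⟩, ?_⟩
    change Multiset.map Subtype.val (b.attach.map (fun e => (⟨e.1, h1 e.1 e.2⟩ : T))) = b
    rw [Multiset.map_map]
    exact Multiset.attach_map_val b

lemma card_msets {α : Type} (T : Finset α) (k : ℕ) :
    (msets T k).card = multichoose T.card k := by
  classical
  unfold msets multichoose
  rw [Finset.card_image_of_injective, Finset.card_univ, Sym.card_sym_eq_multichoose,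
    Nat.multichoose_eq, Fintype.card_coe]
  intro s t h
  exact Subtype.ext (Multiset.map_injective Subtype.val_injective h)

lemma card_msets_support {α : Type} [DecidableEq α] (T : Finset α) (k : ℕ) (L : Finset α) (hL : L ⊆ T) :
    ((msets T k).filter (fun b => b.toFinset = L)).card =
      if L.card ≤ k then multichoose L.card (k - L.card) else 0 := by
  split_ifs with h
  · rw [← card_msets, ← Finset.card_image_of_injective (msets L (k - L.card))
      (add_left_injective L.val)]
    congr 1
    ext b
    simp only [Finset.mem_filter, Finset.mem_image, mem_msets]
    constructor
    · rintro ⟨⟨h1, h2⟩, h3⟩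
      have hle : L.val ≤ b := by
        rw [Finset.val_le_iff_val_subset]
        intro e he
        have : e ∈ b.toFinset := by rw [h3]; exact he
        exact Multiset.mem_toFinset.1 this
      refine ⟨b - L.val, ⟨?_, ?_⟩, tsub_add_cancel_of_le hle⟩
      · intro e he
        rw [← h3]
        exact Multiset.mem_toFinset.2 (Multiset.mem_of_le tsub_le_self he)
      · rw [Multiset.card_sub hle, h2]; rfl
    · rintro ⟨a, ⟨h1, h2⟩, rfl⟩
      refine ⟨⟨?_, ?_⟩, ?_⟩
      · intro e he
        rcases Multiset.mem_add.1 he with he | he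
        · exact hL (h1 e he)
        · exact hL he
      · rw [Multiset.card_add, h2]
        change k - L.card + L.card = k
        omega
      · ext e
        simp only [Multiset.mem_toFinset, Multiset.mem_add, Finset.mem_val]
        exact ⟨fun h => h.elim (h1 e) id, Or.inr⟩
  · rw [Finset.card_eq_zero, Finset.filter_eq_empty_iff]
    intro b hb h3
    rw [mem_msets] at hb
    apply h
    rw [← h3, ← hb.2]
    exact Multiset.toFinset_card_le b

/-- The count of multisets whose support does not satisfy `P`. -/
lemma card_not_support {α : Type} [DecidableEq α] (T : Finset α) (P : Finset α → Prop) (p t m : ℕ)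
    (hT : T.card = p + m) (hP : ∀ L, P L → p ≤ L.card) (d : ℕ → ℕ)
    (hd : ∀ j, d j = {L : Finset α | L ⊆ T ∧ L.card = j ∧ P L}.ncard) :
    {b : Multiset α | b ∈ msets T (t + p) ∧
      ¬ P b.toFinset}.ncard =
      multichoose T.card (t + p) - ∑ j ∈ Finset.range (m + 1),
        (if j ≤ t then d (p + j) * multichoose (p + j) (t - j) else 0) := by
  classical
  have e1 : {b : Multiset α | b ∈ msets T (t + p) ∧ ¬ P b.toFinset} =
      (((msets T (t + p)).filter (fun b => ¬ P b.toFinset) : Finset (Multiset α)) :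
        Set (Multiset α)) := by
    ext b; simp
  have e2 : ((msets T (t + p)).filter (fun b => P b.toFinset)).card =
      ∑ j ∈ Finset.range (m + 1),
        (if j ≤ t then d (p + j) * multichoose (p + j) (t - j) else 0) := by
    rw [Finset.card_eq_sum_card_fiberwise (f := fun b : Multiset α => b.toFinset)
      (t := T.powerset.filter P)]
    · rw [← Finset.sum_fiberwise_of_maps_to (s := T.powerset.filter P)
        (t := Finset.range (m + 1)) (g := fun L => L.card - p)]
      · refine Finset.sum_congr rfl fun j hj => ?_
        have h0 : d (p + j) =
            ((T.powerset.filter P).filter (fun L => L.card - p = j)).card := by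
          rw [hd, ← Set.ncard_coe_finset]
          congr 1
          ext L
          simp only [Set.mem_ofPred_eq, Finset.coe_filter, Finset.mem_filter,
            Finset.mem_powerset]
          constructor
          · rintro ⟨h1, h2, h3⟩
            exact ⟨⟨h1, h3⟩, by omega⟩
          · rintro ⟨⟨h1, h3⟩, h2⟩
            have := hP L h3
            exact ⟨h1, by omega, h3⟩
        have h1 : ∀ L ∈ (T.powerset.filter P).filter (fun L => L.card - p = j),
            (((msets T (t + p)).filter (fun b => P b.toFinset)).filter
              (fun b => b.toFinset = L)).card =
            if j ≤ t then multichoose (p + j) (t - j) else 0 := by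
          intro L hL
          simp only [Finset.mem_filter, Finset.mem_powerset] at hL
          obtain ⟨⟨hLT, hPL⟩, hLj⟩ := hL
          have hpL := hP L hPL
          have hc : L.card = p + j := by omega
          have : ((msets T (t + p)).filter (fun b => P b.toFinset)).filter
              (fun b => b.toFinset = L) =
              (msets T (t + p)).filter (fun b => b.toFinset = L) := by
            ext b
            simp only [Finset.mem_filter]
            constructor
            · rintro ⟨⟨h1, h2⟩, h3⟩; exact ⟨h1, h3⟩
            · rintro ⟨h1, h3⟩; exact ⟨⟨h1, by rw [h3]; exact hPL⟩, h3⟩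
          rw [this, card_msets_support T _ L hLT, hc]
          have e3 : t + p - (p + j) = t - j := by omega
          rw [e3]
          by_cases hjt : j ≤ t
          · rw [if_pos hjt, if_pos (by omega)]
          · rw [if_neg hjt, if_neg (by omega)]
        rw [Finset.sum_congr rfl h1, Finset.sum_const, smul_eq_mul, h0]
        split_ifs <;> simp
      · intro L hL
        simp only [Finset.mem_filter, Finset.mem_powerset] at hL
        have := Finset.card_le_card hL.1
        simp only [Finset.mem_range]
        omega
    · intro b hb
      simp only [Finset.coe_filter, Set.mem_ofPred_eq, mem_msets, Finset.mem_powerset] at hb ⊢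
      exact ⟨fun e he => hb.1.1 e (Multiset.mem_toFinset.1 he), hb.2⟩
  have e3 := Finset.card_filter_add_card_filter_not (s := msets T (t + p))
    (fun b : Multiset α => P b.toFinset)
  rw [card_msets] at e3
  have e4 : {b : Multiset α | b ∈ msets T (t + p) ∧ ¬ P b.toFinset}.ncard =
      ((msets T (t + p)).filter (fun b => ¬ P b.toFinset)).card := by
    rw [e1, Set.ncard_coe_finset]
  rw [e2] at e3
  rw [e4]
  omega

/-! ### Monomial ideals -/

lemma monomial_mem_span {𝕜 V : Type} [Field 𝕜] (A : Set (V →₀ ℕ)) (m : V →₀ ℕ) :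
    (monomial m (1 : 𝕜)) ∈ Ideal.span ((fun s => monomial s (1 : 𝕜)) '' A) ↔
      ∃ a ∈ A, a ≤ m := by
  classical
  rw [mem_ideal_span_monomial_image]
  simp [support_monomial]

lemma monomial_one_dvd {𝕜 V : Type} [Field 𝕜] (a m : V →₀ ℕ) :
    (monomial a (1 : 𝕜)) ∣ monomial m 1 ↔ a ≤ m := by
  rw [monomial_dvd_monomial]; simp

lemma monomial_one_inj {𝕜 V : Type} [Field 𝕜] :
    Function.Injective (fun m : V →₀ ℕ => monomial m (1 : 𝕜)) :=
  monomial_left_injective one_ne_zero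

lemma eq_of_le_of_degree {V : Type} {a b : V →₀ ℕ} (h : a ≤ b) (hd : b.degree = a.degree) :
    a = b := by
  obtain ⟨c, rfl⟩ := le_iff_exists_add.1 h
  rw [map_add] at hd
  have : c.degree = 0 := by omega
  rw [Finsupp.degree_eq_zero_iff] at this
  simp [this]

lemma exists_single_of_degree {V : Type} {a b : V →₀ ℕ} (h : a ≤ b)
    (hd : b.degree = a.degree + 1) : ∃ y, b = a + Finsupp.single y 1 := by
  obtain ⟨c, rfl⟩ := le_iff_exists_add.1 h
  rw [map_add] at hd
  have h1 : c.degree = 1 := by omega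
  have h0 : c ≠ 0 := by rintro rfl; simp at h1
  obtain ⟨y, hy⟩ := Finsupp.ne_iff.1 h0
  refine ⟨y, ?_⟩
  have : Finsupp.single y 1 = c := by
    apply eq_of_le_of_degree
    · rw [Finsupp.single_le_iff]
      simp only [Finsupp.coe_zero, Pi.zero_apply] at hy
      omega
    · simp [h1]
  rw [this]

lemma isMinMonomialGen_iff {𝕜 V : Type} [Field 𝕜] (A : Set (V →₀ ℕ)) (N : ℕ)
    (hA : ∀ a ∈ A, a.degree = N) (f : MvPolynomial V 𝕜) :
    IsMinMonomialGen (Ideal.span ((fun s => monomial s (1 : 𝕜)) '' A)) f ↔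
      ∃ a ∈ A, f = monomial a 1 := by
  constructor
  · rintro ⟨⟨m, rfl⟩, h2, h3⟩
    rw [monomial_mem_span] at h2
    obtain ⟨a, ha, ham⟩ := h2
    refine ⟨a, ha, ?_⟩
    exact (h3 _ ⟨a, rfl⟩ ((monomial_mem_span A a).2 ⟨a, ha, le_rfl⟩)
      ((monomial_one_dvd a m).2 ham)).symm
  · rintro ⟨a, ha, rfl⟩
    refine ⟨⟨a, rfl⟩, (monomial_mem_span A a).2 ⟨a, ha, le_rfl⟩, ?_⟩
    rintro g ⟨m, rfl⟩ hg hd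
    rw [monomial_mem_span] at hg
    rw [monomial_one_dvd] at hd
    obtain ⟨a', ha', hle⟩ := hg
    have h1 : a' = a := eq_of_le_of_degree (hle.trans hd) (by rw [hA _ ha, hA _ ha'])
    subst h1
    rw [le_antisymm hle hd]

lemma span_monomial_mul {𝕜 V : Type} [Field 𝕜] (A B : Set (V →₀ ℕ)) :
    Ideal.span ((fun s => monomial s (1 : 𝕜)) '' A) *
      Ideal.span ((fun s => monomial s (1 : 𝕜)) '' B) =
      Ideal.span ((fun s => monomial s (1 : 𝕜)) '' (Set.image2 (· + ·) A B)) := by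
  rw [Ideal.span_mul_span']
  congr 1
  ext f
  simp only [Set.mem_mul, Set.mem_image, Set.mem_image2]
  constructor
  · rintro ⟨_, ⟨a, ha, rfl⟩, _, ⟨b, hb, rfl⟩, rfl⟩
    exact ⟨a + b, ⟨a, ha, b, hb, rfl⟩, by simp [monomial_mul]⟩
  · rintro ⟨_, ⟨a, ha, b, hb, rfl⟩, rfl⟩
    exact ⟨_, ⟨a, ha, rfl⟩, _, ⟨b, hb, rfl⟩, by simp [monomial_mul]⟩

/-! ### Edge exponent vectors -/

/-- exponent vector of an edge -/
def edgeVec {V : Type} : Sym2 V → (V →₀ ℕ) :=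
  Sym2.lift ⟨fun u v => Finsupp.single u 1 + Finsupp.single v 1, fun _ _ => add_comm _ _⟩

lemma edgeVec_mk {V : Type} (u v : V) :
    edgeVec s(u, v) = Finsupp.single u 1 + Finsupp.single v 1 := rfl

lemma edgeVec_degree {V : Type} (e : Sym2 V) : (edgeVec e).degree = 2 := by
  induction e with
  | _ u v => rw [edgeVec_mk]; simp

lemma edgeVec_pos {V : Type} (e : Sym2 V) (v : V) (h : v ∈ e) : 1 ≤ edgeVec e v := by
  induction e with
  | _ a b =>
    rw [edgeVec_mk]
    rcases Sym2.mem_iff.1 h with rfl | rfl <;> simp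

/-- exponent vector of a multiset of edges -/
def phi {V : Type} (b : Multiset (Sym2 V)) : V →₀ ℕ := (b.map edgeVec).sum

lemma phi_add {V : Type} (a b : Multiset (Sym2 V)) : phi (a + b) = phi a + phi b := by
  simp [phi]

lemma phi_cons {V : Type} (e : Sym2 V) (b : Multiset (Sym2 V)) :
    phi (e ::ₘ b) = edgeVec e + phi b := by
  simp [phi]

lemma phi_degree {V : Type} (b : Multiset (Sym2 V)) : (phi b).degree = 2 * b.card := by
  induction b using Multiset.induction with
  | empty => simp [phi]
  | cons e b ih => rw [phi_cons, map_add, ih, edgeVec_degree, Multiset.card_cons]; ring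

lemma edgeIdeal_pow {𝕜 V : Type} [Field 𝕜] (G : SimpleGraph V) (T : Finset (Sym2 V))
    (hT : ∀ e, e ∈ T ↔ e ∈ G.edgeSet) (k : ℕ) :
    (edgeIdeal 𝕜 G) ^ k =
      Ideal.span ((fun s => monomial s (1 : 𝕜)) '' (phi '' {b | b ∈ msets T k})) := by
  have h1 : edgeIdeal 𝕜 G =
      Ideal.span ((fun s => monomial s (1 : 𝕜)) '' (edgeVec '' {e | e ∈ T})) := by
    unfold edgeIdeal
    congr 1
    ext p
    simp only [Set.mem_ofPred_eq, Set.mem_image]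
    constructor
    · rintro ⟨u, v, h, rfl⟩
      exact ⟨_, ⟨s(u, v), (hT _).2 h, rfl⟩, by simp [edgeVec_mk, X, monomial_mul]⟩
    · rintro ⟨_, ⟨e, he, rfl⟩, rfl⟩
      rw [hT] at he
      induction e with
      | _ u v => exact ⟨u, v, he, by simp [edgeVec_mk, X, monomial_mul]⟩
  induction k with
  | zero =>
    rw [pow_zero, Ideal.one_eq_top, eq_comm, Ideal.eq_top_iff_one]
    apply Ideal.subset_span
    refine ⟨0, ⟨0, ?_, by simp [phi]⟩, by simp⟩
    simp [mem_msets]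
  | succ k ih =>
    rw [pow_succ, ih, h1, span_monomial_mul]
    congr 2
    ext m
    simp only [Set.mem_image2, Set.mem_image, Set.mem_ofPred_eq, mem_msets]
    constructor
    · rintro ⟨_, ⟨b, ⟨hb, hk⟩, rfl⟩, _, ⟨e, he, rfl⟩, rfl⟩
      refine ⟨e ::ₘ b, ⟨?_, by simp [hk]⟩, by rw [phi_cons, add_comm]⟩
      intro e' he'
      rcases Multiset.mem_cons.1 he' with rfl | h
      · exact he
      · exact hb _ h
    · rintro ⟨b, ⟨hb, hk⟩, rfl⟩
      obtain ⟨e, he⟩ := Multiset.card_pos_iff_exists_mem.1 (by omega : 0 < b.card)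
      obtain ⟨b', rfl⟩ := Multiset.exists_cons_of_mem he
      refine ⟨_, ⟨b', ⟨fun e h => hb e (Multiset.mem_cons_of_mem h), by simpa using hk⟩, rfl⟩,
        _, ⟨e, hb e he, rfl⟩, by rw [phi_cons, add_comm]⟩

/-! ### Injectivity of the exponent map -/

lemma phi_pos_exists {V : Type} (b : Multiset (Sym2 V)) (v : V) (h : 1 ≤ phi b v) :
    ∃ e ∈ b, v ∈ e := by
  induction b using Multiset.induction with
  | empty => simp [phi] at h
  | cons e b ih =>
    by_cases hv : v ∈ e
    · exact ⟨e, by simp, hv⟩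
    · have h0 : edgeVec e v = 0 := by
        induction e with
        | _ p q =>
          rw [Sym2.mem_iff, not_or] at hv
          rw [edgeVec_mk]
          simp [Finsupp.single_apply, Ne.symm hv.1, Ne.symm hv.2]
      rw [phi_cons, Finsupp.add_apply, h0, zero_add] at h
      obtain ⟨e', he', h'⟩ := ih h
      exact ⟨e', by simp [he'], h'⟩

lemma phi_ge_of_mem {V : Type} (b : Multiset (Sym2 V)) (e : Sym2 V) (he : e ∈ b) (v : V)
    (h : v ∈ e) : 1 ≤ phi b v := by
  obtain ⟨b', rfl⟩ := Multiset.exists_cons_of_mem he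
  rw [phi_cons, Finsupp.add_apply]
  have := edgeVec_pos e v h
  omega

lemma sum_count_edgeVec {V : Type} [DecidableEq V] (S : Set (Sym2 V)) [Fintype S]
    (a : Multiset (Sym2 V)) (ha : ∀ e ∈ a, e ∈ S) (w : V) :
    ∑ e : S, (Multiset.count e.1 a : ℚ) * (edgeVec e.1 w : ℚ) = (phi a w : ℚ) := by
  induction a using Multiset.induction with
  | empty => simp [phi]
  | cons e b ih =>
    have ih' := ih (fun e' he' => ha e' (Multiset.mem_cons_of_mem he'))
    rw [phi_cons, Finsupp.add_apply, Nat.cast_add, ← ih']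
    have h1 : ∀ e' : S, (Multiset.count e'.1 (e ::ₘ b) : ℚ) * (edgeVec e'.1 w : ℚ) =
        (if e' = ⟨e, ha e (by simp)⟩ then (edgeVec e'.1 w : ℚ) else 0) +
          (Multiset.count e'.1 b : ℚ) * (edgeVec e'.1 w : ℚ) := by
      intro e'
      rw [Multiset.count_cons]
      by_cases h : e' = ⟨e, ha e (by simp)⟩
      · rw [if_pos h, if_pos (by rw [h])]; push_cast; ring
      · rw [if_neg h, if_neg (fun h' => h (Subtype.ext h'))]; push_cast; ring
    rw [Finset.sum_congr rfl (fun e' _ => h1 e'), Finset.sum_add_distrib]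
    simp

lemma phi_inj {V : Type} [Fintype V] [DecidableEq V] (G : SimpleGraph V) (n : ℕ)
    (x : ZMod (2 * n + 1) → V) (hx : IsUnicyclicOddCycle G n x)
    (a b : Multiset (Sym2 V)) (ha : ∀ e ∈ a, e ∈ G.edgeSet) (hb : ∀ e ∈ b, e ∈ G.edgeSet)
    (h : phi a = phi b) : a = b := by
  classical
  let vv : G.edgeSet → (V → ℚ) := fun e w => (edgeVec e.1 w : ℚ)
  set S := Submodule.span ℚ (Set.range vv) with hS
  have hadj : ∀ u w, G.Adj u w →
      (Pi.single u 1 + Pi.single w 1 : V → ℚ) ∈ S := by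
    intro u w huw
    apply Submodule.subset_span
    refine ⟨⟨s(u, w), huw⟩, ?_⟩
    funext z
    simp only [vv, edgeVec_mk, Finsupp.add_apply, Finsupp.single_apply, Pi.add_apply,
      Pi.single_apply, Nat.cast_add, Nat.cast_ite, Nat.cast_one, Nat.cast_zero, eq_comm (a := z)]
  have hstep : ∀ u w, G.Adj u w → (Pi.single u 1 : V → ℚ) ∈ S →
      (Pi.single w 1 : V → ℚ) ∈ S := by
    intro u w huw hu
    have := S.sub_mem (hadj u w huw) hu
    simpa using this
  have hcyc : ∀ j : ℕ, (Pi.single (x (j : ZMod (2 * n + 1))) 1 : V → ℚ)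
      - (-1 : ℚ) ^ j • (Pi.single (x 0) 1 : V → ℚ) ∈ S := by
    intro j
    induction j with
    | zero => simp
    | succ j ih =>
      have h1 := hadj (x (j : ZMod (2 * n + 1))) (x ((j : ZMod (2 * n + 1)) + 1))
        ((hx.adj_iff _ _).2 (Or.inl rfl))
      have h2 := S.sub_mem h1 ih
      have h3 : (Pi.single (x ((j + 1 : ℕ) : ZMod (2 * n + 1))) 1 : V → ℚ)
          - (-1 : ℚ) ^ (j + 1) • (Pi.single (x 0) 1 : V → ℚ) =
          (Pi.single (x (j : ZMod (2 * n + 1))) 1 +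
            Pi.single (x ((j : ZMod (2 * n + 1)) + 1)) 1) -
          ((Pi.single (x (j : ZMod (2 * n + 1))) 1 : V → ℚ)
            - (-1 : ℚ) ^ j • (Pi.single (x 0) 1 : V → ℚ)) := by
        rw [pow_succ, Nat.cast_succ]
        module
      rw [h3]; exact h2
  have h0 : (Pi.single (x 0) 1 : V → ℚ) ∈ S := by
    have h1 := hcyc (2 * n + 1)
    rw [ZMod.natCast_self, pow_succ, pow_mul] at h1
    have h2 := S.smul_mem (1 / 2 : ℚ) h1
    have h3 : (1 / 2 : ℚ) • ((Pi.single (x 0) 1 : V → ℚ)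
        - ((((-1 : ℚ) ^ 2) ^ n) * (-1)) • (Pi.single (x 0) 1 : V → ℚ)) =
        (Pi.single (x 0) 1 : V → ℚ) := by
      norm_num
      module
    rw [h3] at h2
    exact h2
  have hall : ∀ v, (Pi.single v 1 : V → ℚ) ∈ S := by
    intro v
    obtain ⟨p⟩ := hx.connected.preconnected (x 0) v
    have : ∀ u w (p : G.Walk u w), (Pi.single u 1 : V → ℚ) ∈ S →
        (Pi.single w 1 : V → ℚ) ∈ S := by
      intro u w p
      induction p with
      | nil => exact id
      | cons hh _ ih => exact fun hu => ih (hstep _ _ hh hu)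
    exact this _ _ p h0
  have htop : ⊤ ≤ S := by
    rw [← (Pi.basisFun ℚ V).span_eq, Submodule.span_le]
    rintro _ ⟨v, rfl⟩
    rw [Pi.basisFun_apply]
    exact hall v
  have hcard : Fintype.card G.edgeSet = Module.finrank ℚ (V → ℚ) := by
    rw [Module.finrank_fintype_fun_eq_card, ← hx.edge_count, Set.ncard_eq_toFinset_card',
      Set.toFinset_card]
  have hli := linearIndependent_of_top_le_span_of_card_eq_finrank htop hcard
  rw [Fintype.linearIndependent_iff] at hli
  have h4 := hli (fun e => (Multiset.count e.1 a : ℚ) - (Multiset.count e.1 b : ℚ)) (by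
    funext w
    have e1 := sum_count_edgeVec G.edgeSet a ha w
    have e2 := sum_count_edgeVec G.edgeSet b hb w
    simp only [Finset.sum_apply, Pi.smul_apply, smul_eq_mul, Pi.zero_apply, vv, sub_mul,
      Finset.sum_sub_distrib]
    rw [e1, e2, h, sub_self])
  ext e
  by_cases he : e ∈ G.edgeSet
  · have := h4 ⟨e, he⟩
    simp only [sub_eq_zero] at this
    exact_mod_cast this
  · rw [Multiset.count_eq_zero_of_notMem (fun h => he (ha e h)),
      Multiset.count_eq_zero_of_notMem (fun h => he (hb e h))]

/-! ### Covers -/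

/-- exponent vector of the product of cycle vertices -/
def chi {V : Type} (n : ℕ) (x : ZMod (2 * n + 1) → V) : V →₀ ℕ :=
  ∑ j : ZMod (2 * n + 1), Finsupp.single (x j) 1

lemma chi_degree {V : Type} (n : ℕ) (x : ZMod (2 * n + 1) → V) :
    (chi n x).degree = 2 * n + 1 := by
  unfold chi
  rw [map_sum]
  simp [ZMod.card]

lemma chi_cycle {V : Type} (n : ℕ) (x : ZMod (2 * n + 1) → V) (hx : Function.Injective x)
    (j : ZMod (2 * n + 1)) : chi n x (x j) = 1 := by
  classical
  unfold chi
  rw [Finsupp.finsetSum_apply]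
  simp [Finsupp.single_apply, hx.eq_iff]

lemma chi_not_cycle {V : Type} (n : ℕ) (x : ZMod (2 * n + 1) → V) (v : V)
    (hv : v ∉ Set.range x) : chi n x v = 0 := by
  classical
  unfold chi
  rw [Finsupp.finsetSum_apply]
  apply Finset.sum_eq_zero
  intro j _
  rw [Finsupp.single_apply, if_neg]
  rintro rfl
  exact hv ⟨j, rfl⟩

lemma chi_le_of_cover {V : Type} (G : SimpleGraph V) (n : ℕ) (x : ZMod (2 * n + 1) → V)
    (hx : Function.Injective x) (L : Finset (Sym2 V)) (hL : IsEdgeCoverFor G n x L) :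
    chi n x ≤ phi L.val := by
  intro v
  by_cases hv : v ∈ Set.range x
  · obtain ⟨j, rfl⟩ := hv
    rw [chi_cycle n x hx]
    obtain ⟨e, he, h⟩ := hL.2 j
    exact phi_ge_of_mem _ e he _ h
  · rw [chi_not_cycle n x v hv]; exact Nat.zero_le _

lemma cover_card_ge {V : Type} (G : SimpleGraph V) (n : ℕ) (x : ZMod (2 * n + 1) → V)
    (hx : Function.Injective x) (L : Finset (Sym2 V)) (hL : IsEdgeCoverFor G n x L) :
    n + 1 ≤ L.card := by
  obtain ⟨r, hr⟩ := le_iff_exists_add.1 (chi_le_of_cover G n x hx L hL)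
  have := phi_degree L.val
  rw [hr, map_add, chi_degree] at this
  change _ = 2 * L.card at this
  omega

lemma sum_pairs {M : Type} [AddCommMonoid M] (f : ℕ → M) (n : ℕ) :
    f 0 + ∑ k ∈ Finset.range n, (f (2 * k + 1) + f (2 * k + 2)) =
      ∑ m ∈ Finset.range (2 * n + 1), f m := by
  induction n with
  | zero => simp
  | succ n ih =>
    rw [Finset.sum_range_succ, ← add_assoc, ih, show 2 * (n + 1) + 1 = 2 * n + 1 + 1 + 1 by ring,
      Finset.sum_range_succ _ (2 * n + 1 + 1), Finset.sum_range_succ _ (2 * n + 1), add_assoc]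

lemma sum_zmod {M : Type} [AddCommMonoid M] (n : ℕ) (g : ZMod (2 * n + 1) → M)
    (i : ZMod (2 * n + 1)) :
    ∑ m ∈ Finset.range (2 * n + 1), g (i + (m : ZMod (2 * n + 1))) = ∑ j, g j := by
  rw [← Equiv.sum_comp (Equiv.addLeft i) g, Finset.sum_range]
  refine Finset.sum_congr rfl fun m _ => ?_
  congr 1
  change i + _ = i + _
  congr 1
  exact Fin.cast_val_eq_self m

lemma cover_at {V : Type} [Fintype V] [DecidableEq V] (G : SimpleGraph V) (n : ℕ)
    (x : ZMod (2 * n + 1) → V) (hx : IsUnicyclicOddCycle G n x)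
    (i : ZMod (2 * n + 1)) (y : V) (hy : G.Adj (x i) y) :
    ∃ L : Finset (Sym2 V), L.card = n + 1 ∧ IsEdgeCoverFor G n x L ∧ s(x i, y) ∈ L ∧
      phi L.val = chi n x + Finsupp.single y 1 ∧
      ∀ e ∈ L, ∀ v ∈ e, v ∈ Set.range x ∨ v = y := by
  let w : ℕ → V := fun m => x (i + (m : ZMod (2 * n + 1)))
  let u : Multiset (Sym2 V) := s(x i, y) ::ₘ
    (Multiset.range n).map (fun k => s(w (2 * k + 1), w (2 * k + 2)))
  have hphi : phi u = chi n x + Finsupp.single y 1 := by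
    have h1 := sum_pairs (fun m => (Finsupp.single (w m) 1 : V →₀ ℕ)) n
    have h2 := sum_zmod n (fun j => (Finsupp.single (x j) 1 : V →₀ ℕ)) i
    have h3 : chi n x = ∑ j, Finsupp.single (x j) 1 := rfl
    rw [h3, ← h2]
    change _ = ∑ m ∈ Finset.range (2 * n + 1), Finsupp.single (w m) 1 + _
    rw [← h1]
    have h4 : w 0 = x i := by simp [w]
    rw [h4]
    simp only [u, phi_cons, edgeVec_mk]
    unfold phi
    rw [Multiset.map_map]
    change _ + ∑ k ∈ Finset.range n, edgeVec s(w (2 * k + 1), w (2 * k + 2)) = _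
    simp only [edgeVec_mk]
    abel
  have hcard : u.card = n + 1 := by simp [u]
  have hmem : ∀ e ∈ u, e ∈ G.edgeSet ∧ ∀ v ∈ e, v ∈ Set.range x ∨ v = y := by
    intro e he
    rcases Multiset.mem_cons.1 he with rfl | he
    · refine ⟨hy, fun v hv => ?_⟩
      rcases Sym2.mem_iff.1 hv with rfl | rfl
      · exact Or.inl ⟨_, rfl⟩
      · exact Or.inr rfl
    · rw [Multiset.mem_map] at he
      obtain ⟨k, _, rfl⟩ := he
      refine ⟨(hx.adj_iff _ _).2 (Or.inl ?_), fun v hv => ?_⟩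
      · push_cast; ring
      · rcases Sym2.mem_iff.1 hv with rfl | rfl <;> exact Or.inl ⟨_, rfl⟩
  have hcov : IsEdgeCoverFor G n x u.toFinset := by
    refine ⟨fun e he => (hmem e (by simpa using he)).1, fun j => ?_⟩
    have : 1 ≤ phi u (x j) := by
      rw [hphi, Finsupp.add_apply, chi_cycle n x hx.inj]; omega
    obtain ⟨e, he, h⟩ := phi_pos_exists u _ this
    exact ⟨e, by simpa using he, h⟩
  have hge := cover_card_ge G n x hx.inj _ hcov
  have hle := Multiset.toFinset_card_le u
  have heq : u.toFinset.card = u.card := by omega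
  have hnd := Multiset.toFinset_card_eq_card_iff_nodup.1 heq
  refine ⟨u.toFinset, by omega, hcov, by simp [u], ?_, ?_⟩
  · rw [Multiset.toFinset_val, hnd.dedup, hphi]
  · intro e he
    exact (hmem e (by simpa using he)).2

lemma exists_dist {V : Type} [Fintype V] (G : SimpleGraph V) (n : ℕ)
    (x : ZMod (2 * n + 1) → V) (hx : IsUnicyclicOddCycle G n x) :
    ∃ D : V → ℕ, (∀ v, D v = 0 ↔ v ∈ Set.range x) ∧
      ∀ v k, D v = k + 1 → ∃ w, G.Adj v w ∧ D w = k := by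
  let S : V → Set ℕ := fun v => {k | ∃ i, ∃ p : G.Walk v (x i), p.length = k}
  have hne : ∀ v, (S v).Nonempty := by
    intro v
    obtain ⟨p⟩ := hx.connected.preconnected v (x 0)
    exact ⟨p.length, 0, p, rfl⟩
  refine ⟨fun v => sInf (S v), fun v => ⟨fun h => ?_, ?_⟩, fun v k h => ?_⟩
  · obtain ⟨i, p, hp⟩ := Nat.sInf_mem (hne v)
    have h' : p.length = 0 := hp.trans h
    exact ⟨i, (SimpleGraph.Walk.eq_of_length_eq_zero h').symm⟩
  · rintro ⟨i, rfl⟩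
    exact Nat.le_zero.1 (Nat.sInf_le ⟨i, SimpleGraph.Walk.nil, rfl⟩)
  · obtain ⟨i, p, hp⟩ := Nat.sInf_mem (hne v)
    have h' : p.length = k + 1 := hp.trans h
    cases p with
    | nil => simp at h'
    | @cons _ w _ hvw q =>
      refine ⟨w, hvw, ?_⟩
      rw [SimpleGraph.Walk.length_cons] at h'
      have h1 : sInf (S w) ≤ q.length := Nat.sInf_le ⟨i, q, rfl⟩
      obtain ⟨i', q', hq'⟩ := Nat.sInf_mem (hne w)
      have h2 : sInf (S v) ≤ (SimpleGraph.Walk.cons hvw q').length :=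
        Nat.sInf_le ⟨i', _, rfl⟩
      rw [SimpleGraph.Walk.length_cons] at h2
      change sInf (S v) = k + 1 at h
      change sInf (S w) = k
      omega

lemma edge_mem_cycle {V : Type} [Fintype V] (G : SimpleGraph V) (n : ℕ)
    (x : ZMod (2 * n + 1) → V) (hx : IsUnicyclicOddCycle G n x) (e : Sym2 V)
    (he : e ∈ G.edgeSet) (h : ∀ v ∈ e, v ∈ Set.range x) : e ∈ cycleEdges n x := by
  induction e with
  | _ u v =>
    obtain ⟨i, rfl⟩ := h u (by simp)
    obtain ⟨j, rfl⟩ := h v (by simp)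
    rw [SimpleGraph.mem_edgeSet, hx.adj_iff] at he
    rcases he with rfl | rfl
    · exact ⟨i, rfl⟩
    · exact ⟨j, Sym2.eq_swap⟩

lemma cycle_edge_mem {V : Type} (n : ℕ)
    (x : ZMod (2 * n + 1) → V) (e : Sym2 V)
    (he : e ∈ cycleEdges n x) (v : V) (h : v ∈ e) : v ∈ Set.range x := by
  obtain ⟨j, rfl⟩ := he
  rcases Sym2.mem_iff.1 h with rfl | rfl <;> exact ⟨_, rfl⟩

lemma minCover_card {V : Type} [Fintype V] [DecidableEq V] (G : SimpleGraph V) (n : ℕ)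
    (x : ZMod (2 * n + 1) → V) (hx : IsUnicyclicOddCycle G n x) (C : Finset (Sym2 V))
    (hC : IsTypeIMinCover G n x C ∨ IsTypeIIMinCover G n x C) :
    IsEdgeCoverFor G n x C ∧ C.card = n + 1 := by
  rcases hC with hC | hC
  · refine ⟨hC.1.1, le_antisymm ?_ (cover_card_ge G n x hx.inj C hC.1.1)⟩
    obtain ⟨L, h1, h2, -, -, h5⟩ := cover_at G n x hx 0 (x (0 + 1))
      ((hx.adj_iff _ _).2 (Or.inl rfl))
    rw [← h1]
    refine hC.2 L ⟨h2, fun e he => edge_mem_cycle G n x hx e (h2.1 he) fun v hv => ?_⟩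
    rcases h5 e he v hv with h | rfl
    · exact h
    · exact ⟨_, rfl⟩
  · refine ⟨hC.1.1, le_antisymm ?_ (cover_card_ge G n x hx.inj C hC.1.1)⟩
    obtain ⟨D, hD0, hD⟩ := exists_dist G n x hx
    obtain ⟨e, heC, hec⟩ := hC.1.2
    have h1 : ∃ v, D v ≠ 0 := by
      by_contra hcon
      push Not at hcon
      exact hec (edge_mem_cycle G n x hx e (hC.1.1.1 heC) fun v _ => (hD0 v).1 (hcon v))
    have h2 : ∀ k v, D v = k + 1 → ∃ w, D w = 1 := by
      intro k
      induction k with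
      | zero => exact fun v hv => ⟨v, hv⟩
      | succ k ih =>
        intro v hv
        obtain ⟨w, _, hw⟩ := hD v _ hv
        exact ih w hw
    obtain ⟨v, hv⟩ := h1
    obtain ⟨w, hw⟩ := h2 (D v - 1) v (by omega)
    obtain ⟨z, hwz, hz⟩ := hD w 0 hw
    obtain ⟨i, rfl⟩ := (hD0 z).1 hz
    obtain ⟨L, h1, h2, h3, -, -⟩ := cover_at G n x hx i w hwz.symm
    rw [← h1]
    refine hC.2 L ⟨h2, _, h3, fun hcy => ?_⟩
    have := (hD0 w).2 (cycle_edge_mem n x _ hcy w (by simp))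
    omega

lemma minCover_of {V : Type} (G : SimpleGraph V) (n : ℕ)
    (x : ZMod (2 * n + 1) → V) (hx : Function.Injective x) (L : Finset (Sym2 V))
    (hL : IsEdgeCoverFor G n x L) (hc : L.card = n + 1) :
    IsTypeIMinCover G n x L ∨ IsTypeIIMinCover G n x L := by
  by_cases h : (↑L : Set (Sym2 V)) ⊆ cycleEdges n x
  · exact Or.inl ⟨⟨hL, h⟩, fun L' hL' => hc ▸ cover_card_ge G n x hx L' hL'.1⟩
  · rw [Set.not_subset] at h
    exact Or.inr ⟨⟨hL, h⟩, fun L' hL' => hc ▸ cover_card_ge G n x hx L' hL'.1⟩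

lemma key_cover {V : Type} [Fintype V] [DecidableEq V] (G : SimpleGraph V) (n : ℕ)
    (x : ZMod (2 * n + 1) → V) (hx : IsUnicyclicOddCycle G n x) (y : V) :
    ∃ (L : Finset (Sym2 V)) (up um : Multiset (Sym2 V)),
      L.card = n + 1 ∧ IsEdgeCoverFor G n x L ∧ L.val ≤ up ∧ (∀ e ∈ L, e ∉ um) ∧
      (∀ e ∈ up, e ∈ G.edgeSet) ∧ (∀ e ∈ um, e ∈ G.edgeSet) ∧
      phi up = phi um + chi n x + Finsupp.single y 1 := by
  obtain ⟨D, hD0, hD⟩ := exists_dist G n x hx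
  have base : ∀ i y k, G.Adj (x i) y → D y = k →
      ∃ (L : Finset (Sym2 V)) (up um : Multiset (Sym2 V)),
      (L.card = n + 1 ∧ IsEdgeCoverFor G n x L ∧ L.val ≤ up ∧ (∀ e ∈ L, e ∉ um) ∧
      (∀ e ∈ up, e ∈ G.edgeSet) ∧ (∀ e ∈ um, e ∈ G.edgeSet) ∧
      phi up = phi um + chi n x + Finsupp.single y 1) ∧ ∀ e ∈ L, ∀ v ∈ e, D v ≤ k := by
    intro i y k hadj hk
    obtain ⟨L, h1, h2, h3, h4, h5⟩ := cover_at G n x hx i y hadj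
    refine ⟨L, L.val, 0, ⟨h1, h2, le_rfl, by simp, fun e he => h2.1 he, by simp, ?_⟩, ?_⟩
    · rw [h4]; simp [phi]
    · intro e he v hv
      rcases h5 e he v hv with h | rfl
      · rw [(hD0 v).2 h]; exact Nat.zero_le _
      · exact hk.le
  have main : ∀ k y, D y = k → ∃ (L : Finset (Sym2 V)) (up um : Multiset (Sym2 V)),
      (L.card = n + 1 ∧ IsEdgeCoverFor G n x L ∧ L.val ≤ up ∧ (∀ e ∈ L, e ∉ um) ∧
      (∀ e ∈ up, e ∈ G.edgeSet) ∧ (∀ e ∈ um, e ∈ G.edgeSet) ∧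
      phi up = phi um + chi n x + Finsupp.single y 1) ∧ ∀ e ∈ L, ∀ v ∈ e, D v ≤ k := by
    intro k
    induction k using Nat.strong_induction_on with
    | _ k ih =>
      intro y hy
      match k, ih, hy with
      | 0, ih, hy =>
        obtain ⟨j, rfl⟩ := (hD0 y).1 hy
        exact base (j - 1) (x j) 0 ((hx.adj_iff _ _).2 (Or.inl (by ring))) hy
      | 1, ih, hy =>
        obtain ⟨z, hyz, hz⟩ := hD y 0 hy
        obtain ⟨i, rfl⟩ := (hD0 z).1 hz
        exact base i y 1 hyz.symm hy
      | k + 2, ih, hy =>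
        obtain ⟨p, hyp, hp⟩ := hD y (k + 1) hy
        obtain ⟨q, hpq, hq⟩ := hD p k hp
        obtain ⟨L, up, um, ⟨h1, h2, h3, h4, h5, h6, h7⟩, h8⟩ := ih k (by omega) q hq
        refine ⟨L, s(y, p) ::ₘ up, s(p, q) ::ₘ um,
          ⟨h1, h2, h3.trans (Multiset.le_cons_self _ _), ?_, ?_, ?_, ?_⟩, ?_⟩
        · intro e he hmem
          rcases Multiset.mem_cons.1 hmem with rfl | hmem
          · have := h8 _ he p (by simp)
            omega
          · exact h4 e he hmem
        · intro e he
          rcases Multiset.mem_cons.1 he with rfl | he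
          · exact hyp
          · exact h5 e he
        · intro e he
          rcases Multiset.mem_cons.1 he with rfl | he
          · exact hpq
          · exact h6 e he
        · rw [phi_cons, phi_cons, h7, edgeVec_mk, edgeVec_mk]
          abel
        · intro e he v hv
          have := h8 e he v hv
          omega
  obtain ⟨L, up, um, h, -⟩ := main (D y) y rfl
  exact ⟨L, up, um, h⟩

lemma core_iff {V : Type} [Fintype V] [DecidableEq V] (G : SimpleGraph V) (n : ℕ)
    (x : ZMod (2 * n + 1) → V) (hx : IsUnicyclicOddCycle G n x) (T : Finset (Sym2 V))
    (hT : ∀ e, e ∈ T ↔ e ∈ G.edgeSet) (t : ℕ) (b : Multiset (Sym2 V))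
    (hb : b ∈ msets T (t + (n + 1))) :
    (∃ a ∈ msets T t, phi a + chi n x ≤ phi b) ↔
      ∃ C : Finset (Sym2 V), (IsTypeIMinCover G n x C ∨ IsTypeIIMinCover G n x C) ∧
        C ⊆ b.toFinset := by
  rw [mem_msets] at hb
  have hbG : ∀ e ∈ b, e ∈ G.edgeSet := fun e he => (hT e).1 (hb.1 e he)
  constructor
  · rintro ⟨a, ha, hle⟩
    rw [mem_msets] at ha
    have haG : ∀ e ∈ a, e ∈ G.edgeSet := fun e he => (hT e).1 (ha.1 e he)
    obtain ⟨y, hy⟩ := exists_single_of_degree hle (by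
      rw [map_add, phi_degree, phi_degree, chi_degree, ha.2, hb.2]; ring)
    obtain ⟨L, up, um, h1, h2, h3, h4, h5, h6, h7⟩ := key_cover G n x hx y
    have heq : b + um = a + up := by
      apply phi_inj G n x hx
      · intro e he
        exact (Multiset.mem_add.1 he).elim (hbG e) (h6 e)
      · intro e he
        exact (Multiset.mem_add.1 he).elim (haG e) (h5 e)
      · rw [phi_add, phi_add, h7, hy]
        abel
    refine ⟨L, minCover_of G n x hx.inj L h2 h1, fun e he => ?_⟩
    have : e ∈ b + um := by
      rw [heq]
      exact Multiset.mem_add.2 (Or.inr (Multiset.mem_of_le h3 he))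
    rw [Multiset.mem_toFinset]
    exact (Multiset.mem_add.1 this).resolve_right (h4 e he)
  · rintro ⟨C, hC, hCb⟩
    obtain ⟨hcov, hcard⟩ := minCover_card G n x hx C hC
    have hle : C.val ≤ b := by
      rw [Finset.val_le_iff_val_subset]
      intro e he
      exact Multiset.mem_toFinset.1 (hCb he)
    refine ⟨b - C.val, ?_, ?_⟩
    · rw [mem_msets]
      refine ⟨fun e he => hb.1 e (Multiset.mem_of_le tsub_le_self he), ?_⟩
      rw [Multiset.card_sub hle, hb.2]
      change t + (n + 1) - C.card = t
      omega
    · conv_rhs => rw [← tsub_add_cancel_of_le hle, phi_add]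
      exact add_le_add le_rfl (chi_le_of_cover G n x hx.inj C hcov)

/-- the count of minimal monomial generators of `I^{s-(n+1)}` that are not
multiples of any minimal monomial generator of `I^{s-2(n+1)}·(c)`, for the edge ideal `I` of a
unicyclic graph with unique odd cycle `C_{2n+1}`; terms with `s - 2(n+1) - j < 0` vanish. -/
theorem unicyclic_G_set_count {V : Type} [Fintype V] [DecidableEq V] (𝕜 : Type) [Field 𝕜]
    (G : SimpleGraph V) (n : ℕ) (hn : 1 ≤ n)
    (x : ZMod (2 * n + 1) → V) (hx : IsUnicyclicOddCycle G n x)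
    (c : MvPolynomial V 𝕜) (hc : c = ∏ j : ZMod (2 * n + 1), X (x j))
    (l : ℕ) (hl : l = G.edgeSet.ncard - (2 * n + 1))
    (d : ℕ → ℕ)
    (hd : ∀ j : ℕ, d j =
      {L : Finset (Sym2 V) | (↑L : Set (Sym2 V)) ⊆ G.edgeSet ∧ L.card = j ∧
        ∃ C : Finset (Sym2 V), (IsTypeIMinCover G n x C ∨ IsTypeIIMinCover G n x C) ∧
          C ⊆ L}.ncard)
    (s : ℕ) (hs : 2 * n + 2 ≤ s) :
    {f : MvPolynomial V 𝕜 |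
        IsMinMonomialGen ((edgeIdeal 𝕜 G) ^ (s - (n + 1))) f ∧
        ¬ ∃ g : MvPolynomial V 𝕜,
          IsMinMonomialGen ((edgeIdeal 𝕜 G) ^ (s - 2 * (n + 1)) * Ideal.span {c}) g ∧
            g ∣ f}.ncard =
      multichoose (2 * n + 1 + l) (s - (n + 1)) -
        ∑ j ∈ Finset.range (n + l + 1),
          (if j ≤ s - 2 * (n + 1) then
            d (n + 1 + j) * multichoose (n + 1 + j) (s - 2 * (n + 1) - j)
          else 0) := by
  classical
  have hfin : G.edgeSet.Finite := Set.toFinite _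
  set T : Finset (Sym2 V) := hfin.toFinset with hTdef
  have hT : ∀ e, e ∈ T ↔ e ∈ G.edgeSet := fun e => hfin.mem_toFinset
  have hTcard : T.card = 2 * n + 1 + l := by
    have h1 : G.edgeSet.ncard = T.card := Set.ncard_eq_toFinset_card _ hfin
    have h2 : 2 * n + 1 ≤ Fintype.card V := by
      have := Fintype.card_le_of_injective x hx.inj
      rwa [ZMod.card] at this
    have h3 := hx.edge_count
    omega
  obtain ⟨t, rfl⟩ : ∃ t, s = t + 2 * (n + 1) := ⟨s - 2 * (n + 1), by omega⟩
  have e1 : t + 2 * (n + 1) - (n + 1) = t + (n + 1) := by omega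
  have e2 : t + 2 * (n + 1) - 2 * (n + 1) = t := by omega
  rw [e1, e2]
  have hcm : c = monomial (chi n x) 1 := by
    rw [hc, chi]
    simp only [X]
    rw [← monomial_sum_one]
  have hI2 : (edgeIdeal 𝕜 G) ^ t * Ideal.span {c} =
      Ideal.span ((fun s => monomial s (1 : 𝕜)) ''
        (Set.image2 (· + ·) (phi '' {b | b ∈ msets T t}) {chi n x})) := by
    rw [← span_monomial_mul, edgeIdeal_pow G T hT, Set.image_singleton, hcm]
  have hgen1 : ∀ f : MvPolynomial V 𝕜, IsMinMonomialGen ((edgeIdeal 𝕜 G) ^ (t + (n + 1))) f ↔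
      ∃ b ∈ msets T (t + (n + 1)), f = monomial (phi b) 1 := by
    intro f
    rw [edgeIdeal_pow G T hT, isMinMonomialGen_iff _ (2 * (t + (n + 1)))]
    · simp
    · rintro _ ⟨b, hb, rfl⟩
      rw [phi_degree, ((mem_msets _ _ _).1 hb).2]
  have hgen2 : ∀ f : MvPolynomial V 𝕜,
      IsMinMonomialGen ((edgeIdeal 𝕜 G) ^ t * Ideal.span {c}) f ↔
      ∃ a ∈ msets T t, f = monomial (phi a + chi n x) 1 := by
    intro f
    rw [hI2, isMinMonomialGen_iff _ (2 * t + (2 * n + 1))]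
    · simp
    · rintro _ ⟨_, ⟨b, hb, rfl⟩, _, rfl, rfl⟩
      change (phi b + chi n x).degree = _
      rw [map_add, phi_degree, ((mem_msets _ _ _).1 hb).2, chi_degree]
  let P : Finset (Sym2 V) → Prop := fun L =>
    ∃ C : Finset (Sym2 V), (IsTypeIMinCover G n x C ∨ IsTypeIIMinCover G n x C) ∧ C ⊆ L
  have hset : {f : MvPolynomial V 𝕜 |
        IsMinMonomialGen ((edgeIdeal 𝕜 G) ^ (t + (n + 1))) f ∧
        ¬ ∃ g : MvPolynomial V 𝕜,
          IsMinMonomialGen ((edgeIdeal 𝕜 G) ^ t * Ideal.span {c}) g ∧ g ∣ f} =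
      (fun b => monomial (phi b) (1 : 𝕜)) ''
        {b | b ∈ msets T (t + (n + 1)) ∧ ¬ P b.toFinset} := by
    have key : ∀ b ∈ msets T (t + (n + 1)), (∃ g : MvPolynomial V 𝕜,
        IsMinMonomialGen ((edgeIdeal 𝕜 G) ^ t * Ideal.span {c}) g ∧
          g ∣ monomial (phi b) (1 : 𝕜)) ↔ P b.toFinset := by
      intro b hb
      refine Iff.trans ?_ (core_iff G n x hx T hT t b hb)
      constructor
      · rintro ⟨g, hg, hd⟩
        obtain ⟨a, ha, rfl⟩ := (hgen2 g).1 hg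
        exact ⟨a, ha, (monomial_one_dvd _ _).1 hd⟩
      · rintro ⟨a, ha, hle⟩
        exact ⟨_, (hgen2 _).2 ⟨a, ha, rfl⟩, (monomial_one_dvd _ _).2 hle⟩
    ext f
    constructor
    · rintro ⟨h1, h2⟩
      obtain ⟨b, hb, rfl⟩ := (hgen1 f).1 h1
      exact ⟨b, ⟨hb, fun h => h2 ((key b hb).2 h)⟩, rfl⟩
    · rintro ⟨b, ⟨hb, h⟩, rfl⟩
      exact ⟨(hgen1 _).2 ⟨b, hb, rfl⟩, fun h2 => h ((key b hb).1 h2)⟩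
  rw [hset, Set.InjOn.ncard_image]
  · have := card_not_support T P (n + 1) t (n + l) (by omega) (by
      rintro L ⟨C, hC, hCL⟩
      rw [← (minCover_card G n x hx C hC).2]
      exact Finset.card_le_card hCL) d (by
      intro j
      rw [hd j]
      congr 1
      ext L
      have : (↑L : Set (Sym2 V)) ⊆ G.edgeSet ↔ L ⊆ T :=
        ⟨fun h e he => (hT e).2 (h he), fun h e he => (hT e).1 (h he)⟩
      change _ ∧ _ ↔ _ ∧ _
      rw [this])
    rw [hTcard] at this
    exact this
  · rintro a ⟨ha, -⟩ b ⟨hb, -⟩ hab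
    apply phi_inj G n x hx
    · exact fun e he => (hT e).1 (((mem_msets _ _ _).1 ha).1 e he)
    · exact fun e he => (hT e).1 (((mem_msets _ _ _).1 hb).1 e he)
    · exact monomial_one_inj hab

end
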